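/- Let H ∈ (1/2, 1). Then the function T ↦ N(T)/2 has no oblique asymptote: for every pair of real numbers m and b, it is not the case that N(T)/2 − (m·T + b) tends to 0 as T → ∞. -/

import Mathlib

open Real MeasureTheory intervalIntegral Filter

/-- `fBmNormSq H T` is the squared norm `‖f_T‖²` expressed as the fourfold integral,
for `H ∈ (1/2,1)`. -/
noncomputable def fBmNormSq (H T : ℝ) : ℝ :=
  H ^ 2 * (2 * H - 1) ^ 2 *
    ∫ t₁ in (0:ℝ)..T, ∫ t₂ in (0:ℝ)..T, ∫ s₁ in (0:ℝ)..T, ∫ s₂ in (0:ℝ)..T,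
      Real.exp (-|t₁ - s₁| - |t₂ - s₂|) * |t₂ - t₁| ^ (2 * H - 2) * |s₁ - s₂| ^ (2 * H - 2)

/-- The integrand of `fBmNormSq`, at the point `((t₁, t₂), (s₁, s₂))`. -/
noncomputable def fBmKernel (H : ℝ) (z : (ℝ × ℝ) × (ℝ × ℝ)) : ℝ :=
  Real.exp (-|z.1.1 - z.2.1| - |z.1.2 - z.2.2|) * |z.1.2 - z.1.1| ^ (2 * H - 2) *
    |z.2.1 - z.2.2| ^ (2 * H - 2)

/-- The product `I × J × I × J`, which is where `(t₁, s₁) ∈ I²` and `(t₂, s₂) ∈ J²`. -/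
def doubledRect (I J : Set ℝ) : Set ((ℝ × ℝ) × (ℝ × ℝ)) := (I ×ˢ J) ×ˢ (I ×ˢ J)

lemma measurableSet_doubledRect {I J : Set ℝ} (hI : MeasurableSet I) (hJ : MeasurableSet J) :
    MeasurableSet (doubledRect I J) :=
  (hI.prod hJ).prod (hI.prod hJ)

lemma doubledRect_mono {I I' J J' : Set ℝ} (hI : I ⊆ I') (hJ : J ⊆ J') :
    doubledRect I J ⊆ doubledRect I' J' :=
  Set.prod_mono (Set.prod_mono hI hJ) (Set.prod_mono hI hJ)

lemma fBmKernel_nonneg (H : ℝ) (z : (ℝ × ℝ) × (ℝ × ℝ)) : 0 ≤ fBmKernel H z := by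
  unfold fBmKernel; positivity

lemma measurable_fBmKernel (H : ℝ) : Measurable (fBmKernel H) := by
  unfold fBmKernel; fun_prop

lemma integrableOn_abs_rpow {r : ℝ} (hr : -1 < r) {T : ℝ} (hT : 0 ≤ T) :
    IntegrableOn (fun x : ℝ => |x| ^ r) (Set.Ioc (-T) T) := by
  have h1 : IntervalIntegrable (fun x : ℝ => |x| ^ r) volume 0 T :=
    (intervalIntegrable_rpow' hr).congr fun x hx => by
      rw [Set.uIoc_of_le hT] at hx
      simp only [abs_of_pos hx.1]
  have h2 : IntervalIntegrable (fun x : ℝ => |x| ^ r) volume (-T) 0 := by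
    have := (IntervalIntegrable.iff_comp_neg (a := 0) (b := T)).1 h1
    simpa using this.symm
  exact (intervalIntegrable_iff_integrableOn_Ioc_of_le (by linarith)).1 (h2.trans h1)

lemma integrableOn_abs_sub_rpow {r : ℝ} (hr : -1 < r) {T : ℝ} (hT : 0 ≤ T) :
    IntegrableOn (fun p : ℝ × ℝ => |p.2 - p.1| ^ r) (Set.Ioc 0 T ×ˢ Set.Ioc 0 T) := by
  have hprod : IntegrableOn (fun q : ℝ × ℝ => 1 * |q.2| ^ r)
      (Set.Ioc 0 T ×ˢ Set.Ioc (-T) T) := by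
    rw [IntegrableOn, Measure.volume_eq_prod, ← Measure.prod_restrict]
    exact Integrable.mul_prod (f := fun _ => (1 : ℝ)) (integrable_const 1)
      (integrableOn_abs_rpow hr hT)
  have hshear := ((measurePreserving_prod_neg_add (volume : Measure ℝ)
    (volume : Measure ℝ)).integrableOn_comp_preimage
      (MeasurableEquiv.shearAddRight ℝ).symm.measurableEmbedding).2 hprod
  refine (hshear.mono_set ?_).congr_fun ?_ (measurableSet_Ioc.prod measurableSet_Ioc)
  · rintro ⟨x, y⟩ ⟨⟨_, _⟩, _, _⟩
    simp only [Set.mem_preimage, Set.mem_prod, Set.mem_Ioc] at *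
    refine ⟨⟨?_, ?_⟩, ?_, ?_⟩ <;> linarith
  · intro p _
    simp [neg_add_eq_sub]

lemma fBmKernel_le (H : ℝ) (z : (ℝ × ℝ) × (ℝ × ℝ)) :
    fBmKernel H z ≤ |z.1.2 - z.1.1| ^ (2 * H - 2) * |z.2.2 - z.2.1| ^ (2 * H - 2) := by
  unfold fBmKernel
  rw [abs_sub_comm z.2.1 z.2.2, mul_assoc]
  refine mul_le_of_le_one_left (by positivity) (Real.exp_le_one_iff.2 ?_)
  linarith [abs_nonneg (z.1.1 - z.2.1), abs_nonneg (z.1.2 - z.2.2)]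

lemma integrableOn_fBmKernel {H : ℝ} (hH : 1 / 2 < H) {T : ℝ} (hT : 0 ≤ T) :
    IntegrableOn (fBmKernel H) (doubledRect (Set.Ioc 0 T) (Set.Ioc 0 T)) := by
  have h := integrableOn_abs_sub_rpow (r := 2 * H - 2) (by linarith) hT
  have hprod : IntegrableOn (fun z : (ℝ × ℝ) × (ℝ × ℝ) =>
      |z.1.2 - z.1.1| ^ (2 * H - 2) * |z.2.2 - z.2.1| ^ (2 * H - 2))
      (doubledRect (Set.Ioc 0 T) (Set.Ioc 0 T)) := by
    rw [IntegrableOn, Measure.volume_eq_prod, doubledRect, ← Measure.prod_restrict]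
    exact Integrable.mul_prod h h
  refine Integrable.mono' hprod (measurable_fBmKernel H).aestronglyMeasurable
    (Eventually.of_forall fun z => ?_)
  rw [Real.norm_of_nonneg (fBmKernel_nonneg H z)]
  exact fBmKernel_le H z

lemma integrableOn_fBmKernel_right {H : ℝ} (hH : 1 / 2 < H) {T : ℝ} (hT : 0 ≤ T) (p : ℝ × ℝ) :
    IntegrableOn (fun q => fBmKernel H (p, q)) (Set.Ioc 0 T ×ˢ Set.Ioc 0 T) := by
  have h := integrableOn_abs_sub_rpow (r := 2 * H - 2) (by linarith) hT
  refine Integrable.mono' (h.const_mul (|p.2 - p.1| ^ (2 * H - 2)))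
    ((measurable_fBmKernel H).comp measurable_prodMk_left).aestronglyMeasurable
    (Eventually.of_forall fun q => ?_)
  rw [Real.norm_of_nonneg (fBmKernel_nonneg H _)]
  exact fBmKernel_le H (p, q)

lemma fBmNormSq_eq_setIntegral {H : ℝ} (hH : 1 / 2 < H) {T : ℝ} (hT : 0 ≤ T) :
    fBmNormSq H T = H ^ 2 * (2 * H - 1) ^ 2 *
      ∫ z in doubledRect (Set.Ioc 0 T) (Set.Ioc 0 T), fBmKernel H z := by
  have hint := integrableOn_fBmKernel hH hT
  have hright := integrableOn_fBmKernel_right hH hT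
  unfold fBmNormSq
  congr 1
  simp only [integral_of_le hT]
  rw [IntegrableOn, Measure.volume_eq_prod, doubledRect, ← Measure.prod_restrict] at hint
  rw [Measure.volume_eq_prod, doubledRect, ← Measure.prod_restrict, integral_prod _ hint]
  have houter := hint.integral_prod_left
  rw [Measure.volume_eq_prod, ← Measure.prod_restrict] at houter ⊢
  rw [integral_prod _ houter]
  refine integral_congr_ae (Eventually.of_forall fun t₁ =>
    integral_congr_ae (Eventually.of_forall fun t₂ => ?_))
  have hr := hright (t₁, t₂)
  rw [IntegrableOn, Measure.volume_eq_prod, ← Measure.prod_restrict] at hr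
  exact (integral_prod _ hr).symm

lemma setIntegral_fBmKernel_shift (H T : ℝ) :
    ∫ z in doubledRect (Set.Ioc T (2 * T)) (Set.Ioc T (2 * T)), fBmKernel H z =
      ∫ z in doubledRect (Set.Ioc 0 T) (Set.Ioc 0 T), fBmKernel H z := by
  have : (volume : Measure ((ℝ × ℝ) × (ℝ × ℝ))).IsAddLeftInvariant :=
    inferInstanceAs (((volume : Measure (ℝ × ℝ)).prod volume).IsAddLeftInvariant)
  have h := (measurePreserving_add_left (volume : Measure ((ℝ × ℝ) × (ℝ × ℝ)))
    ((T, T), (T, T))).setIntegral_preimage_emb (measurableEmbedding_addLeft _) (fBmKernel H)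
      (doubledRect (Set.Ioc T (2 * T)) (Set.Ioc T (2 * T)))
  rw [← h]
  congr 1
  · congr 1
    ext ⟨⟨a, b⟩, c, d⟩
    simp [doubledRect, two_mul]
  · ext z
    simp [fBmKernel]

/-- The part of `{0 < t₁, s₁ ≤ T < t₂, s₂ ≤ 2T}` on which `s₁ - t₁` and `s₂ - t₂` are in `(0, 1]`
and `t₁ ≤ T - 1`, `t₂ ≤ 2T - 1`. -/
def crossStrip (T : ℝ) : Set ((ℝ × ℝ) × (ℝ × ℝ)) :=
  (fun z => (z.1, -z.1 + z.2)) ⁻¹'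
    ((Set.Ioc 0 (T - 1) ×ˢ Set.Ioc T (2 * T - 1)) ×ˢ (Set.Ioc 0 1 ×ˢ Set.Ioc 0 1))

lemma measurableSet_crossStrip (T : ℝ) : MeasurableSet (crossStrip T) :=
  (by fun_prop : Measurable fun z : (ℝ × ℝ) × (ℝ × ℝ) => (z.1, -z.1 + z.2))
    ((measurableSet_Ioc.prod measurableSet_Ioc).prod (measurableSet_Ioc.prod measurableSet_Ioc))

lemma volume_crossStrip {T : ℝ} (hT : 1 ≤ T) :
    volume (crossStrip T) = ENNReal.ofReal ((T - 1) ^ 2) := by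
  have h := (measurePreserving_prod_neg_add (volume : Measure (ℝ × ℝ))
    (volume : Measure (ℝ × ℝ))).measure_preimage
      (s := (Set.Ioc 0 (T - 1) ×ˢ Set.Ioc T (2 * T - 1)) ×ˢ (Set.Ioc 0 1 ×ˢ Set.Ioc 0 1))
      ((measurableSet_Ioc.prod measurableSet_Ioc).prod
        (measurableSet_Ioc.prod measurableSet_Ioc)).nullMeasurableSet
  refine h.trans ?_
  simp only [Measure.volume_eq_prod, Measure.prod_prod, Real.volume_Ioc]
  rw [show 2 * T - 1 - T = T - 1 by ring, ← ENNReal.ofReal_mul (by linarith)]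
  simp [sq]

lemma crossStrip_subset (T : ℝ) :
    crossStrip T ⊆ doubledRect (Set.Ioc 0 T) (Set.Ioc T (2 * T)) := by
  rintro ⟨⟨a, b⟩, c, d⟩ h
  simp only [crossStrip, doubledRect, Set.mem_preimage, Set.mem_prod, Set.mem_Ioc, Prod.fst_add,
    Prod.snd_add, Prod.fst_neg, Prod.snd_neg] at h ⊢
  obtain ⟨⟨⟨_, _⟩, _, _⟩, ⟨_, _⟩, _, _⟩ := h
  refine ⟨⟨⟨?_, ?_⟩, ?_, ?_⟩, ⟨?_, ?_⟩, ?_, ?_⟩ <;> linarith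

lemma le_fBmKernel_of_mem_crossStrip {H : ℝ} (hH : H ≤ 1) {T : ℝ} {z : (ℝ × ℝ) × (ℝ × ℝ)}
    (hz : z ∈ crossStrip T) :
    Real.exp (-2) * ((2 * T) ^ (2 * H - 2) * (2 * T) ^ (2 * H - 2)) ≤ fBmKernel H z := by
  have hsub := crossStrip_subset T hz
  obtain ⟨⟨a, b⟩, c, d⟩ := z
  simp only [crossStrip, doubledRect, Set.mem_preimage, Set.mem_prod, Set.mem_Ioc, Prod.fst_add,
    Prod.snd_add, Prod.fst_neg, Prod.snd_neg] at hz hsub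
  obtain ⟨⟨⟨_, _⟩, _, _⟩, ⟨_, _⟩, _, _⟩ := hz
  obtain ⟨⟨⟨_, _⟩, _, _⟩, ⟨_, _⟩, _, _⟩ := hsub
  have hac : |a - c| ≤ 1 := abs_le.2 ⟨by linarith, by linarith⟩
  have hbd : |b - d| ≤ 1 := abs_le.2 ⟨by linarith, by linarith⟩
  have hab : (2 * T) ^ (2 * H - 2) ≤ |b - a| ^ (2 * H - 2) :=
    rpow_le_rpow_of_nonpos (abs_pos.2 (by linarith)) (abs_le.2 ⟨by linarith, by linarith⟩)
      (by linarith)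
  have hcd : (2 * T) ^ (2 * H - 2) ≤ |c - d| ^ (2 * H - 2) :=
    rpow_le_rpow_of_nonpos (abs_pos.2 (by linarith)) (abs_le.2 ⟨by linarith, by linarith⟩)
      (by linarith)
  have hT : 0 ≤ 2 * T := by linarith
  unfold fBmKernel
  rw [← mul_assoc]
  gcongr
  linarith

lemma two_mul_fBmNormSq_add_le {H : ℝ} (hH : 1 / 2 < H) (hH1 : H ≤ 1) {T : ℝ} (hT : 1 ≤ T) :
    2 * fBmNormSq H T + H ^ 2 * (2 * H - 1) ^ 2 *
      (Real.exp (-2) * ((2 * T) ^ (2 * H - 2) * (2 * T) ^ (2 * H - 2)) * (T - 1) ^ 2) ≤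
      fBmNormSq H (2 * T) := by
  rw [fBmNormSq_eq_setIntegral hH (by linarith : 0 ≤ T),
    fBmNormSq_eq_setIntegral hH (by linarith : 0 ≤ 2 * T)]
  have hint := integrableOn_fBmKernel hH (by linarith : 0 ≤ 2 * T)
  have hlow : Set.Ioc 0 T ⊆ Set.Ioc 0 (2 * T) := Set.Ioc_subset_Ioc le_rfl (by linarith)
  have hhigh : Set.Ioc T (2 * T) ⊆ Set.Ioc 0 (2 * T) := Set.Ioc_subset_Ioc (by linarith) le_rfl
  set A := doubledRect (Set.Ioc 0 T) (Set.Ioc 0 T)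
  set B := doubledRect (Set.Ioc T (2 * T)) (Set.Ioc T (2 * T)) with hB
  have hA_sub : A ⊆ doubledRect (Set.Ioc 0 (2 * T)) (Set.Ioc 0 (2 * T)) :=
    doubledRect_mono hlow hlow
  have hB_sub : B ⊆ doubledRect (Set.Ioc 0 (2 * T)) (Set.Ioc 0 (2 * T)) :=
    doubledRect_mono hhigh hhigh
  have hC_sub : crossStrip T ⊆ doubledRect (Set.Ioc 0 (2 * T)) (Set.Ioc 0 (2 * T)) :=
    (crossStrip_subset T).trans (doubledRect_mono hlow hhigh)
  have hBm : MeasurableSet B := measurableSet_doubledRect measurableSet_Ioc measurableSet_Ioc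
  have hAB : Disjoint A B := Set.disjoint_left.2 fun z hA hB =>
    absurd hA.1.1.2 (not_le.2 hB.1.1.1)
  have hABC : Disjoint (A ∪ B) (crossStrip T) := by
    refine Set.disjoint_left.2 fun z hz hC => ?_
    have hC' := crossStrip_subset T hC
    rcases hz with hA | hB
    · exact absurd hA.1.2.2 (not_le.2 hC'.1.2.1)
    · exact absurd hC'.1.1.2 (not_le.2 hB.1.1.1)
  have hunion : ∫ z in (A ∪ B) ∪ crossStrip T, fBmKernel H z =
      2 * (∫ z in A, fBmKernel H z) + ∫ z in crossStrip T, fBmKernel H z := by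
    rw [setIntegral_union hABC (measurableSet_crossStrip T)
        (hint.mono_set (Set.union_subset hA_sub hB_sub)) (hint.mono_set hC_sub),
      setIntegral_union hAB hBm (hint.mono_set hA_sub) (hint.mono_set hB_sub), hB,
      setIntegral_fBmKernel_shift, two_mul]
  have hmono := setIntegral_mono_set hint (Eventually.of_forall (fBmKernel_nonneg H))
    (Set.union_subset (Set.union_subset hA_sub hB_sub) hC_sub).eventuallyLE
  have hcross := setIntegral_ge_of_const_le_real (measurableSet_crossStrip T)
    (by simp [volume_crossStrip hT]) (fun z hz => le_fBmKernel_of_mem_crossStrip hH1 hz)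
    (hint.mono_set hC_sub)
  rw [measureReal_def, volume_crossStrip hT, ENNReal.toReal_ofReal (sq_nonneg _)] at hcross
  rw [hunion] at hmono
  rw [mul_left_comm, ← mul_add]
  gcongr
  linarith

lemma tendsto_crossStrip_bound {H : ℝ} (hH : 1 / 2 < H) :
    Tendsto (fun T : ℝ => H ^ 2 * (2 * H - 1) ^ 2 *
      (Real.exp (-2) * ((2 * T) ^ (2 * H - 2) * (2 * T) ^ (2 * H - 2)) * (T - 1) ^ 2))
      atTop atTop := by
  have hc : 0 < H ^ 2 * (2 * H - 1) ^ 2 * (Real.exp (-2) / 16) := by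
    have : 0 < 2 * H - 1 := by linarith
    have : 0 < H := by linarith
    positivity
  have hpow : Tendsto (fun T : ℝ => (2 * T) ^ (4 * H - 2)) atTop atTop :=
    (tendsto_rpow_atTop (by linarith)).comp (tendsto_id.const_mul_atTop two_pos)
  refine tendsto_atTop_mono' _ ?_ (hpow.const_mul_atTop hc)
  filter_upwards [eventually_ge_atTop 2] with T hT
  have hsplit : (2 * T) ^ (4 * H - 2) =
      (2 * T) ^ (2 * H - 2) * (2 * T) ^ (2 * H - 2) * (2 * T) ^ 2 := by
    rw [← rpow_natCast, ← rpow_add (by linarith), ← rpow_add (by linarith)]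
    congr 1
    push_cast
    ring
  have hsq : (2 * T) ^ 2 / 16 ≤ (T - 1) ^ 2 := by nlinarith
  rw [hsplit]
  calc _ = H ^ 2 * (2 * H - 1) ^ 2 * (Real.exp (-2) *
        ((2 * T) ^ (2 * H - 2) * (2 * T) ^ (2 * H - 2)) * ((2 * T) ^ 2 / 16)) := by ring
    _ ≤ _ := by
      have : 0 ≤ 2 * T := by linarith
      gcongr

theorem stmt_7 (H : ℝ) (hH : H ∈ Set.Ioo (1/2 : ℝ) 1) :
    ∀ m b : ℝ,
      ¬ Tendsto (fun T : ℝ => fBmNormSq H T / 2 - (m * T + b)) atTop (nhds 0) := by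
  intro m b hlim
  have hdouble := hlim.comp (tendsto_id.const_mul_atTop (two_pos (α := ℝ)))
  have hdiff := ((hdouble.sub (hlim.const_mul 2)).sub_const b).const_mul 2
  refine not_tendsto_nhds_of_tendsto_atTop ?_ _ hdiff
  refine tendsto_atTop_mono' _ ?_ (tendsto_crossStrip_bound hH.1)
  filter_upwards [eventually_ge_atTop 1] with T hT
  have := two_mul_fBmNormSq_add_le hH.1 hH.2.le hT
  simp only [Function.comp_apply, id]
  linarith
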